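/- Let (X₁,d_{X₁}),…,(Xₙ,d_{Xₙ}) be nonempty metric spaces and let d be a metric on P = X₁ × ⋯ × Xₙ. Then the following are equivalent: (i) there exists an isotone metric preserving function Ψ : ℝ₊ⁿ → ℝ₊ such that d((x₁,…,xₙ),(y₁,…,yₙ)) = Ψ(d_{X₁}(x₁,y₁),…,d_{Xₙ}(xₙ,yₙ)) for all points of P; (ii) d is an isotone subadditive metric product, i.e., there exists a function Φ : D_{X₁} × ⋯ × D_{Xₙ} → ℝ₊ which is isotone and subadditive in the sense of Definition 2.7 and satisfies d((x₁,…,xₙ),(y₁,…,yₙ)) = Φ(d_{X₁}(x₁,y₁),…,d_{Xₙ}(xₙ,yₙ)) for all points of P. -/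

import Mathlib

open scoped NNReal

/-- `d` is a metric on `α`. -/
def IsMetric {α : Type*} (d : α → α → ℝ) : Prop :=
  (∀ x y, 0 ≤ d x y) ∧ (∀ x y, d x y = 0 ↔ x = y) ∧ (∀ x y, d x y = d y x) ∧
    ∀ x y z, d x z ≤ d x y + d y z

/-- `Φ : ℝ₊ⁿ → ℝ₊` is a metric preserving function of `n` variables. -/
def MetricPreserving (n : ℕ) (Φ : (Fin n → ℝ≥0) → ℝ≥0) : Prop :=
  ∀ (Y : Fin n → Type*) [∀ i, MetricSpace (Y i)],
    IsMetric (fun x y : ∀ i, Y i => ((Φ fun i => nndist (x i) (y i) : ℝ≥0) : ℝ))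

/-- Subadditivity in the sense of Definition 2.7 on a set `A ⊆ ℝ₊ⁿ`. -/
def SubadditiveOnSet (n : ℕ) (A : Set (Fin n → ℝ≥0)) (Φ : (Fin n → ℝ≥0) → ℝ≥0) : Prop :=
  ∀ (m : ℕ), 2 ≤ m → ∀ x ∈ A, ∀ xs : Fin m → Fin n → ℝ≥0,
    (∀ i, xs i ∈ A) → x ≤ ∑ i, xs i → Φ x ≤ ∑ i, Φ (xs i)

open scoped Classical in
theorem core_extension (n : ℕ) (D : Fin n → Set ℝ≥0) (h0 : ∀ i, 0 ∈ D i)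
    (Φ : (Fin n → ℝ≥0) → ℝ≥0)
    (hsub : SubadditiveOnSet n {v : Fin n → ℝ≥0 | ∀ i, v i ∈ D i} Φ)
    (hz : Φ 0 = 0) (hpos : ∀ v : Fin n → ℝ≥0, (∀ i, v i ∈ D i) → Φ v = 0 → v = 0) :
    ∃ Ψ : (Fin n → ℝ≥0) → ℝ≥0, Monotone Ψ ∧ (∀ a b, Ψ (a + b) ≤ Ψ a + Ψ b) ∧
      (∀ v, Ψ v = 0 ↔ v = 0) ∧ ∀ v : Fin n → ℝ≥0, (∀ i, v i ∈ D i) → Ψ v = Φ v := by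
  have hl : ∀ l : List (Fin n → ℝ≥0), (∀ x ∈ l, ∀ i, x i ∈ D i) →
      ∀ x : Fin n → ℝ≥0, (∀ i, x i ∈ D i) → x ≤ l.sum → Φ x ≤ (l.map Φ).sum := by
    intro l hlA x hx hxl
    have hA : ∀ y ∈ (0 :: 0 :: l), ∀ i, y i ∈ D i := by
      intro y hy
      simp only [List.mem_cons] at hy
      rcases hy with rfl | rfl | hy
      · exact h0
      · exact h0
      · exact hlA y hy
    have key := hsub (0 :: 0 :: l).length (by simp) x hx (fun k => (0 :: 0 :: l).get k)
      (fun k => hA _ (List.get_mem _ _))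
    have e1 : ∑ k, (0 :: 0 :: l).get k = l.sum := by
      rw [← List.sum_ofFn, List.ofFn_get]; simp
    have e2 : ∑ k, Φ ((0 :: 0 :: l).get k) = (l.map Φ).sum := by
      have : (List.ofFn fun k => Φ ((0 :: 0 :: l).get k)) = (0 :: 0 :: l).map Φ := by
        conv_rhs => rw [← List.ofFn_get (0 :: 0 :: l), List.map_ofFn]
        rfl
      rw [← List.sum_ofFn, this]; simp [hz]
    rw [e1, e2] at key
    exact key hxl
  let J : Fin n → Prop := fun i => ∃ t ∈ D i, 0 < t
  let S : (Fin n → ℝ≥0) → Set ℝ≥0 := fun v =>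
    {r | ∃ l : List (Fin n → ℝ≥0), (∀ x ∈ l, ∀ i, x i ∈ D i) ∧
      (∀ i, J i → v i ≤ l.sum i) ∧ r = (l.map Φ).sum}
  have hne : ∀ v, (S v).Nonempty := by
    intro v
    have : ∀ i, ∃ t ∈ D i, J i → 0 < t := by
      intro i
      by_cases h : J i
      · obtain ⟨t, ht, htp⟩ := h
        exact ⟨t, ht, fun _ => htp⟩
      · exact ⟨0, h0 i, fun h' => absurd h' h⟩
    choose t htD htp using this
    have hN : ∀ i, ∃ N : ℕ, J i → v i ≤ N * t i := by
      intro i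
      by_cases h : J i
      · obtain ⟨N, hN⟩ := Archimedean.arch (v i) (htp i h)
        exact ⟨N, fun _ => by simpa using hN⟩
      · exact ⟨0, fun h' => absurd h' h⟩
    choose N hN using hN
    refine ⟨_, List.replicate (∑ i, N i) t, ?_, ?_, rfl⟩
    · intro x hx
      rw [List.eq_of_mem_replicate hx]; exact htD
    · intro i hi
      refine (hN i hi).trans ?_
      have : N i ≤ ∑ i, N i := Finset.single_le_sum (fun _ _ => Nat.zero_le _) (Finset.mem_univ i)
      rw [List.sum_replicate, Pi.smul_apply, nsmul_eq_mul]
      gcongr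
  have hbdd : ∀ v, BddBelow (S v) := fun v => OrderBot.bddBelow _
  have hmono : ∀ u v, u ≤ v → sInf (S u) ≤ sInf (S v) := by
    intro u v huv
    refine csInf_le_csInf (hbdd u) (hne v) ?_
    rintro r ⟨l, h1, h2, h3⟩
    exact ⟨l, h1, fun i hi => (huv i).trans (h2 i hi), h3⟩
  have hadd : ∀ u v, sInf (S (u + v)) ≤ sInf (S u) + sInf (S v) := by
    intro u v
    refine le_of_forall_pos_le_add fun ε hε => ?_
    have hε2 : 0 < ε / 2 := by positivity
    obtain ⟨r, ⟨l, h1, h2, rfl⟩, hr⟩ := exists_lt_of_csInf_lt (hne u) (lt_add_of_pos_right _ hε2)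
    obtain ⟨s, ⟨k, g1, g2, rfl⟩, hs⟩ := exists_lt_of_csInf_lt (hne v) (lt_add_of_pos_right _ hε2)
    have : sInf (S (u + v)) ≤ (l.map Φ).sum + (k.map Φ).sum := by
      refine csInf_le (hbdd _) ⟨l ++ k, ?_, ?_, by simp⟩
      · intro x hx
        rcases List.mem_append.1 hx with hx | hx
        · exact h1 x hx
        · exact g1 x hx
      · intro i hi
        rw [List.sum_append]
        exact add_le_add (h2 i hi) (g2 i hi)
    calc _ ≤ _ := this
      _ ≤ (sInf (S u) + ε / 2) + (sInf (S v) + ε / 2) := add_le_add hr.le hs.le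
      _ = sInf (S u) + sInf (S v) + (ε / 2 + ε / 2) := by ring
      _ = _ := by rw [add_halves]
  have hJz : ∀ v : Fin n → ℝ≥0, (∀ i, v i ∈ D i) → ∀ i, ¬ J i → v i = 0 := by
    intro v hv i hi
    by_contra h
    exact hi ⟨v i, hv i, pos_iff_ne_zero.2 h⟩
  have heq : ∀ v : Fin n → ℝ≥0, (∀ i, v i ∈ D i) → sInf (S v) = Φ v := by
    intro v hv
    apply le_antisymm
    · exact csInf_le (hbdd _) ⟨[v], by simpa using hv, by simp, by simp⟩
    · refine le_csInf (hne v) ?_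
      rintro r ⟨l, h1, h2, rfl⟩
      refine hl l h1 v hv fun i => ?_
      by_cases hi : J i
      · exact h2 i hi
      · rw [hJz v hv i hi]; exact zero_le
  have hlow : ∀ v i, J i → v i ≠ 0 → 0 < sInf (S v) := by
    intro v i hi hvi
    obtain ⟨t, htD, ht⟩ := hi
    have hsD : ∀ j, (Pi.single i t : Fin n → ℝ≥0) j ∈ D j := by
      intro j
      by_cases hj : j = i
      · subst hj; simpa using htD
      · simpa [hj] using h0 j
    have hc : 0 < Φ (Pi.single i t) := by
      rw [pos_iff_ne_zero]
      intro h
      have := congrFun (hpos _ hsD h) i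
      simp at this
      exact ht.ne' this
    obtain ⟨N, hN⟩ := Archimedean.arch t (pos_iff_ne_zero.2 hvi)
    rw [nsmul_eq_mul] at hN
    have hNp : (0 : ℝ≥0) < N := by
      rw [pos_iff_ne_zero]; intro h; rw [h, zero_mul] at hN
      exact absurd hN (not_le.2 ht)
    refine lt_of_lt_of_le (div_pos hc hNp) (le_csInf (hne v) ?_)
    rintro r ⟨l, h1, h2, rfl⟩
    rw [div_le_iff₀ hNp]
    have := hl (List.replicate N l).flatten (by
        intro x hx
        obtain ⟨k, hk, hxk⟩ := List.mem_flatten.1 hx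
        rw [List.eq_of_mem_replicate hk] at hxk
        exact h1 x hxk) _ hsD (by
        intro j
        rw [List.sum_flatten, List.map_replicate, List.sum_replicate, Pi.smul_apply, nsmul_eq_mul]
        by_cases hj : j = i
        · subst hj
          rw [Pi.single_eq_same]
          refine hN.trans ?_
          have := h2 j ⟨t, htD, ht⟩
          gcongr
        · rw [Pi.single_eq_of_ne hj]; exact zero_le)
    rw [List.map_flatten, List.sum_flatten, List.map_replicate, List.map_replicate,
      List.sum_replicate, nsmul_eq_mul, mul_comm] at this
    exact this
  refine ⟨fun v => sInf (S v) + ∑ i, if J i then 0 else v i, ?_, ?_, ?_, ?_⟩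
  · intro u v huv
    refine add_le_add (hmono u v huv) (Finset.sum_le_sum fun i _ => ?_)
    split_ifs
    · exact le_rfl
    · exact huv i
  · intro u v
    have : (∑ i, if J i then 0 else (u + v) i) =
        (∑ i, if J i then 0 else u i) + ∑ i, if J i then 0 else v i := by
      rw [← Finset.sum_add_distrib]
      refine Finset.sum_congr rfl fun i _ => ?_
      split_ifs <;> simp
    calc _ ≤ (sInf (S u) + sInf (S v)) + ((∑ i, if J i then 0 else u i) + ∑ i, if J i then 0 else v i) :=
          add_le_add (hadd u v) this.le
      _ = _ := by ring
  · intro v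
    constructor
    · intro h
      obtain ⟨ha, hb⟩ := add_eq_zero.1 h
      funext i
      by_contra hi
      by_cases hJ : J i
      · exact (hlow v i hJ hi).ne' ha
      · have := Finset.sum_eq_zero_iff.1 hb i (Finset.mem_univ i)
        rw [if_neg hJ] at this
        exact hi this
    · rintro rfl
      show sInf (S 0) + _ = 0
      rw [heq 0 h0, hz]; simp
  · intro v hv
    show sInf (S v) + _ = _
    rw [heq v hv, Finset.sum_eq_zero, add_zero]
    intro i _
    split_ifs with h
    · rfl
    · exact hJz v hv i h

theorem zero_and_add.{u} {n : ℕ} {Ψ : (Fin n → ℝ≥0) → ℝ≥0} (hp : MetricPreserving.{u} n Ψ) :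
    Ψ 0 = 0 ∧ ∀ a b, Ψ (a + b) ≤ Ψ a + Ψ b := by
  have hM := hp (fun _ => ULift.{u} ℝ)
  have h0 : Ψ 0 = 0 := by
    have := (hM.2.1 (fun _ => ULift.up.{u} 0) (fun _ => ULift.up.{u} 0)).2 rfl
    have h2 : Ψ (fun _ => nndist (ULift.up.{u} (0 : ℝ)) (ULift.up.{u} 0)) = 0 := NNReal.coe_eq_zero.1 this
    rw [← h2]; congr 1; funext i; simp
  have hadd : ∀ a b, Ψ (a + b) ≤ Ψ a + Ψ b := by
    intro a b
    have := hM.2.2.2 (fun _ => ULift.up.{u} 0) (fun i => ULift.up.{u} (a i : ℝ))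
      (fun i => ULift.up.{u} ((a i : ℝ) + b i))
    have e1 : (fun i => nndist (ULift.up.{u} (0 : ℝ)) (ULift.up.{u} ((a i : ℝ) + b i))) = a + b := by
      funext i
      apply NNReal.coe_injective
      rw [coe_nndist, ULift.dist_eq, Real.dist_eq]
      simp only [zero_sub, abs_neg, Pi.add_apply, NNReal.coe_add]
      exact abs_of_nonneg (by positivity)
    have e2 : (fun i => nndist (ULift.up.{u} (0 : ℝ)) (ULift.up.{u} (a i : ℝ))) = a := by
      funext i
      apply NNReal.coe_injective
      rw [coe_nndist, ULift.dist_eq, Real.dist_eq]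
      simp
    have e3 : (fun i => nndist (ULift.up.{u} (a i : ℝ)) (ULift.up.{u} ((a i : ℝ) + b i))) = b := by
      funext i
      apply NNReal.coe_injective
      rw [coe_nndist, ULift.dist_eq, Real.dist_eq]
      simp
    simp only [e1, e2, e3] at this
    exact_mod_cast this
  exact ⟨h0, hadd⟩

/-- Theorem 3.9. For nonempty metric spaces `X₁,…,Xₙ` and a metric `d`
on `P = X₁ × ⋯ × Xₙ`, the following are equivalent: (i) there is an isotone metric
preserving `Ψ : ℝ₊ⁿ → ℝ₊` with `d = Ψ(d₁,…,dₙ)`; (ii) `d` is an isotone subadditive metric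
product, i.e. `d = Φ(d₁,…,dₙ)` for a function `Φ` on the product of the distance sets which
is isotone and subadditive in the sense of Definition 2.7. -/
theorem stmt_11 (n : ℕ) (hn : 0 < n) (X : Fin n → Type*) [∀ i, MetricSpace (X i)]
    [∀ i, Nonempty (X i)]
    (d : (∀ i, X i) → (∀ i, X i) → ℝ) (hd : IsMetric d) :
    (∃ Ψ : (Fin n → ℝ≥0) → ℝ≥0, Monotone Ψ ∧ MetricPreserving n Ψ ∧
        ∀ x y : ∀ i, X i, d x y = Ψ fun i => nndist (x i) (y i)) ↔
      (∃ Φ : (Fin n → ℝ≥0) → ℝ≥0,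
        MonotoneOn Φ {v : Fin n → ℝ≥0 | ∀ i, ∃ a b : X i, nndist a b = v i} ∧
        SubadditiveOnSet n {v : Fin n → ℝ≥0 | ∀ i, ∃ a b : X i, nndist a b = v i} Φ ∧
        ∀ x y : ∀ i, X i, d x y = Φ fun i => nndist (x i) (y i)) := by
  constructor
  · rintro ⟨Ψ, hm, hp, he⟩
    refine ⟨Ψ, hm.monotoneOn _, ?_, he⟩
    obtain ⟨h0, hadd⟩ := zero_and_add hp
    intro m _ x _ xs _ hx
    exact (hm hx).trans (Finset.le_sum_of_subadditive Ψ h0.le hadd _ _)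
  · rintro ⟨Φ, hm, hs, he⟩
    have hz : Φ 0 = 0 := by
      let p : ∀ i, X i := fun i => Classical.arbitrary _
      have h1 := he p p
      rw [(hd.2.1 p p).2 rfl] at h1
      have h2 : (fun i => nndist (p i) (p i)) = 0 := by funext i; simp
      rw [h2] at h1
      exact_mod_cast h1.symm
    obtain ⟨Ψ, h1, h2, h3, h4⟩ := core_extension n (fun i => {t | ∃ a b : X i, nndist a b = t})
      (fun i => ⟨Classical.arbitrary _, Classical.arbitrary _, by simp⟩) Φ hs hz (by
        intro v hv h
        choose a b hab using hv
        have hv' : (fun i => nndist (a i) (b i)) = v := funext hab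
        have h5 := he a b
        rw [hv', h, NNReal.coe_zero, hd.2.1] at h5
        rw [← hv', h5]; funext i; simp)
    refine ⟨Ψ, h1, ?_, ?_⟩
    · intro Y _
      refine ⟨fun _ _ => NNReal.coe_nonneg _, ?_, ?_, ?_⟩
      · intro x y
        rw [NNReal.coe_eq_zero, h3, funext_iff, funext_iff]
        simp
      · intro x y
        simp only [nndist_comm]
      · intro x y z
        rw [← NNReal.coe_add, NNReal.coe_le_coe]
        exact (h1 fun i => nndist_triangle (x i) (y i) (z i)).trans (h2 _ _)
    · intro x y
      rw [he, h4]
      exact fun i => ⟨_, _, rfl⟩
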